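/- For any word u of length n ≥ 1, the sum σ_cubic(u) of the exponents of all cubic runs in u satisfies σ_cubic(u) < 3·ρ_cubic(u) + n, where ρ_cubic(u) is the number of cubic runs in u. -/

import Mathlib

open scoped Classical

namespace RunsExp

variable {α : Type*}

/-- `p` is a period of the word `w`. -/
def IsPeriod (w : List α) (p : ℕ) : Prop :=
  0 < p ∧ ∀ i : ℕ, i + p < w.length → w[i]? = w[i + p]?

/-- The shortest period of the word `w`. -/
noncomputable def minPeriod (w : List α) : ℕ := sInf {p | IsPeriod w p}

/-- The factor `u[i..j]` of `u` (0-based indices, inclusive on both ends). -/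
def factor (u : List α) (i j : ℕ) : List α := (u.drop i).take (j - i + 1)

/-- `[i..j]` is a run in `u` (0-based indices): the shortest period `p` of `u[i..j]`
satisfies `2p ≤ j-i+1` and the interval can be extended neither to the left nor to
the right without violating this property. -/
def IsRun (u : List α) (i j : ℕ) : Prop :=
  i ≤ j ∧ j < u.length ∧
  2 * minPeriod (factor u i j) ≤ j - i + 1 ∧
  (i = 0 ∨ u[i - 1]? ≠ u[i + minPeriod (factor u i j) - 1]?) ∧
  (j = u.length - 1 ∨ u[j - minPeriod (factor u i j) + 1]? ≠ u[j + 1]?)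

/-- The exponent of the run `[i..j]` of `u`. -/
noncomputable def exponent (u : List α) (i j : ℕ) : ℚ :=
  ((j : ℚ) - (i : ℚ) + 1) / (minPeriod (factor u i j) : ℚ)

/-- The set of all runs of `u`, as a finset of pairs of indices. -/
noncomputable def runs (u : List α) : Finset (ℕ × ℕ) :=
  (Finset.range u.length ×ˢ Finset.range u.length).filter fun q => IsRun u q.1 q.2

/-- The sum of exponents of all runs in `u`. -/
noncomputable def sigma (u : List α) : ℚ :=
  ∑ q ∈ runs u, exponent u q.1 q.2

/-- The lexicographically minimal word cyclically equivalent to `w`. -/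
noncomputable def minRot [LinearOrder α] (w : List α) : List α :=
  ((List.range w.length).map w.rotate).foldr min w

/-- The lexicographically maximal word cyclically equivalent to `w`. -/
noncomputable def maxRot [LinearOrder α] (w : List α) : List α :=
  ((List.range w.length).map w.rotate).foldr max w

/-- The word `x` occurs in `u` at (0-based) starting position `s`, entirely within
the interval `[i..j]`. -/
def OccursAt (u : List α) (i j : ℕ) (x : List α) (s : ℕ) : Prop :=
  i ≤ s ∧ s + x.length ≤ j + 1 ∧ factor u s (s + x.length - 1) = x

/-- `s` and `s'` are starting positions of consecutive occurrences of `x`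
inside the interval `[i..j]` of `u`. -/
def ConsecutiveOcc (u : List α) (i j : ℕ) (x : List α) (s s' : ℕ) : Prop :=
  OccursAt u i j x s ∧ OccursAt u i j x s' ∧ s < s' ∧
    ∀ t, s < t → t < s' → ¬ OccursAt u i j x t

/-- The set of handles of the run `[i..j]` of `u`: inter-position `k` lies between
the letters at positions `k` and `k+1`.  If the minimal and maximal rotations of the
period-prefix `w` coincide, all inter-positions inside the run are handles; otherwise
the handles are the inter-positions between consecutive occurrences of the minimal
rotation and between consecutive occurrences of the maximal rotation. -/
noncomputable def handles [LinearOrder α] (u : List α) (i j : ℕ) : Set ℕ :=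
  let p := minPeriod (factor u i j)
  let w := factor u i (i + p - 1)
  if minRot w = maxRot w then
    {k | i ≤ k ∧ k < j}
  else
    {k | ∃ s s', (ConsecutiveOcc u i j (minRot w) s s' ∨
                  ConsecutiveOcc u i j (maxRot w) s s') ∧ k = s' - 1}

/-- `[i..j]` is a cubic run in `u`. -/
def IsCubicRun (u : List α) (i j : ℕ) : Prop :=
  IsRun u i j ∧ 3 * minPeriod (factor u i j) ≤ j - i + 1

/-- The set of all cubic runs of `u`. -/
noncomputable def cubicRuns (u : List α) : Finset (ℕ × ℕ) :=
  (Finset.range u.length ×ˢ Finset.range u.length).filter fun q => IsCubicRun u q.1 q.2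

/-- The sum of exponents of all cubic runs in `u`. -/
noncomputable def sigmaCubic (u : List α) : ℚ :=
  ∑ q ∈ cubicRuns u, exponent u q.1 q.2



theorem aux_append_lt [LinearOrder α] (a b x y : List α) (hl : a.length = b.length)
    (h : a < b) : a ++ x < b ++ y := by
  induction a generalizing b with
  | nil => cases b with
    | nil => simp at h
    | cons c b => simp at hl
  | cons d a ih => cases b with
    | nil => simp at hl
    | cons c b =>
      simp only [List.cons_append, List.cons_lt_cons_iff] at h ⊢
      rcases h with h | ⟨h1, h2⟩
      · exact Or.inl h
      · exact Or.inr ⟨h1, ih b (by simpa using hl) h2⟩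

theorem aux_lt_append [LinearOrder α] (a b x : List α) (h : a < b) : x ++ a < x ++ b := by
  induction x with
  | nil => simpa using h
  | cons d x ih =>
    simp only [List.cons_append, List.cons_lt_cons_iff]
    exact Or.inr ⟨trivial, ih⟩

/-- the window of length `m` starting at `s` -/
def win (f : ℕ → α) (s m : ℕ) : List α := (List.range m).map fun t => f (s + t)

theorem win_add (f : ℕ → α) (s m k : ℕ) : win f s (m + k) = win f s m ++ win f (s + m) k := by
  simp [win, List.range_add, Function.comp_def, Nat.add_assoc]

theorem win_congr (f : ℕ → α) (s s' m : ℕ) (h : ∀ t < m, f (s + t) = f (s' + t)) :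
    win f s m = win f s' m := by
  unfold win
  apply List.map_congr_left
  intro t ht
  exact h t (by simpa using ht)

theorem win_inj (f : ℕ → α) (s s' m : ℕ) (h : win f s m = win f s' m) :
    ∀ t < m, f (s + t) = f (s' + t) := by
  unfold win at h
  intro t ht
  exact List.map_inj_left.1 h t (by simpa using ht)

theorem aux_mod (f : ℕ → α) (p : ℕ) (hf : ∀ t, f (t + p) = f t) (m : ℕ) :
    ∀ t, f (t + m * p) = f t := by
  induction m with
  | zero => simp
  | succ m ih => intro t; rw [Nat.succ_mul, ← Nat.add_assoc, hf, ih]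

theorem exists_unbordered [LinearOrder α] (f : ℕ → α) (p : ℕ) (hp : 0 < p)
    (hf : ∀ t, f (t + p) = f t)
    (hmin : ∀ q, 0 < q → q < p → ∃ t, f (t + q) ≠ f t) :
    ∃ s < p, ∀ k, 0 < k → k < p → ∃ t < k, f (s + t) ≠ f (s + (p - k) + t) := by
  obtain ⟨s, hs, hsm⟩ := Finset.exists_min_image (Finset.range p) (fun s => win f s p)
    ⟨0, by simpa using hp⟩
  have hall : ∀ r, win f s p ≤ win f r p := by
    intro r
    have h1 := hsm (r % p) (by simpa using Nat.mod_lt r hp)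
    have h2 : win f (r % p) p = win f r p := by
      apply win_congr
      intro t _
      have := aux_mod f p hf (r / p) (r % p + t)
      rw [← this]
      congr 1
      have := Nat.mod_add_div r p
      rw [Nat.mul_comm] at this
      omega
    rw [← h2]; exact h1
  refine ⟨s, by simpa using hs, ?_⟩
  intro k hk hkp
  by_contra hcon
  push Not at hcon
  have hx : win f s k = win f (s + (p - k)) k := win_congr _ _ _ _ hcon
  have e1 : win f s p = win f s k ++ win f (s + k) (p - k) := by
    rw [← win_add]; congr 1; omega
  have e2 : win f s p = win f s (p - k) ++ win f s k := by
    conv_rhs => rw [hx]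
    rw [← win_add]; congr 1; omega
  have e3 : win f (s + k) p = win f (s + k) (p - k) ++ win f s k := by
    have : win f s k = win f (s + k + (p - k)) k := by
      apply win_congr
      intro t _
      rw [← hf (s + t)]; congr 1; omega
    rw [this, ← win_add]; congr 1; omega
  have e4 : win f (s + (p - k)) p = win f s k ++ win f s (p - k) := by
    have : win f s (p - k) = win f (s + (p - k) + k) (p - k) := by
      apply win_congr
      intro t _
      rw [← hf (s + t)]; congr 1; omega
    rw [this, hx, ← win_add]; congr 1; omega
  have hv : win f s (p - k) = win f (s + k) (p - k) := by
    rcases lt_trichotomy (win f s (p - k)) (win f (s + k) (p - k)) with h | h | h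
    · exfalso
      have := hall (s + (p - k))
      rw [e4, e1] at this
      exact absurd (aux_lt_append _ _ (win f s k) h) (not_lt.2 this)
    · exact h
    · exfalso
      have := hall (s + k)
      rw [e3, e2] at this
      exact absurd (aux_append_lt _ _ (win f s k) (win f s k) (by simp [win]) h) (not_lt.2 this)
  have hw : win f s p = win f (s + k) p := by rw [e3, e2, hv]
  have hw' := win_inj _ _ _ _ hw
  obtain ⟨t, ht⟩ := hmin k hk hkp
  apply ht
  -- t + m p = s + r + (..) p
  have h1 := aux_mod f p hf s
  -- t + s*p ≥ s
  obtain ⟨d, hd⟩ : ∃ d, t + s * p = s + d := ⟨t + s * p - s, by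
    have : s ≤ s * p := Nat.le_mul_of_pos_right s hp
    omega⟩
  have hdm := Nat.mod_add_div d p
  rw [Nat.mul_comm] at hdm
  have h2 := hw' (d % p) (Nat.mod_lt d hp)
  have h3 := aux_mod f p hf (d / p) (s + d % p)
  have h4 := aux_mod f p hf (d / p) (s + k + d % p)
  calc f (t + k) = f (t + k + s * p) := (h1 _).symm
    _ = f (s + k + d % p + d / p * p) := by congr 1; omega
    _ = f (s + d % p + d / p * p) := by rw [h4, h3, h2]
    _ = f (t + s * p) := by congr 1; omega
    _ = f t := h1 t

theorem factor_get (u : List α) (i j t : ℕ) (h : i + t ≤ j) :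
    (factor u i j)[t]? = u[i + t]? := by
  unfold factor
  rw [List.getElem?_take_of_lt (by omega), List.getElem?_drop]

theorem factor_len (u : List α) (i j : ℕ) (hij : i ≤ j) (hj : j < u.length) :
    (factor u i j).length = j - i + 1 := by
  unfold factor; simp; omega

theorem minPeriod_isPeriod (w : List α) : IsPeriod w (minPeriod w) := by
  have : minPeriod w ∈ {p | IsPeriod w p} :=
    Nat.sInf_mem ⟨w.length + 1, by omega, fun i h => by omega⟩
  exact this

theorem run_per (u : List α) (i j : ℕ) (hij : i ≤ j) (hj : j < u.length) (a : ℕ)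
    (ha : i ≤ a) (hb : a + minPeriod (factor u i j) ≤ j) :
    u[a]? = u[a + minPeriod (factor u i j)]? := by
  have h := (minPeriod_isPeriod (factor u i j)).2 (a - i)
    (by rw [factor_len u i j hij hj]; omega)
  rw [factor_get _ _ _ _ (by omega), factor_get _ _ _ _ (by omega)] at h
  rw [show i + (a - i) = a by omega] at h
  rw [h]; congr 1; omega

theorem run_min (u : List α) (i j : ℕ) (hij : i ≤ j) (hj : j < u.length) (q : ℕ)
    (hq : 0 < q) (hqp : q < minPeriod (factor u i j)) :
    ∃ a, i ≤ a ∧ a + q ≤ j ∧ u[a]? ≠ u[a + q]? := by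
  by_contra hcon
  push Not at hcon
  have : IsPeriod (factor u i j) q := by
    refine ⟨hq, fun t ht => ?_⟩
    rw [factor_len u i j hij hj] at ht
    rw [factor_get _ _ _ _ (by omega), factor_get _ _ _ _ (by omega),
      hcon (i + t) (by omega) (by omega)]
    congr 1; omega
  have h2 : minPeriod (factor u i j) ≤ q := Nat.sInf_le this
  omega

/-- centers of squares of unbordered roots -/
noncomputable def centers (u : List α) (i j : ℕ) : Finset ℕ :=
  (Finset.Ico 1 u.length).filter fun s =>
    i + minPeriod (factor u i j) ≤ s ∧ s + minPeriod (factor u i j) ≤ j + 1 ∧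
    ∀ k, 0 < k → k < minPeriod (factor u i j) →
      ∃ t < k, u[s + t]? ≠ u[s + (minPeriod (factor u i j) - k) + t]?

theorem centers_aux (u : List α) (i j i' j' s : ℕ) (h : IsRun u i j) (h' : IsRun u i' j')
    (hs : s ∈ centers u i j) (hs' : s ∈ centers u i' j') :
    minPeriod (factor u i' j') ≤ minPeriod (factor u i j) := by
  by_contra hlt
  push Not at hlt
  obtain ⟨hij, hj, -, -, -⟩ := h
  obtain ⟨hij', hj', -, -, -⟩ := h'
  have hp0 := (minPeriod_isPeriod (factor u i j)).1
  have per := run_per u i j hij hj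
  have per' := run_per u i' j' hij' hj'
  simp only [centers, Finset.mem_filter] at hs hs'
  obtain ⟨-, a1, a2, a3⟩ := hs
  obtain ⟨-, b1, b2, b3⟩ := hs'
  generalize minPeriod (factor u i j) = p at *
  generalize minPeriod (factor u i' j') = p' at *
  obtain ⟨t, ht, hne⟩ := b3 p hp0 hlt
  apply hne
  have e1 := per (s - p + t) (by omega) (by omega)
  have e2 := per' (s - p + t) (by omega) (by omega)
  rw [show s - p + t + p = s + t by omega] at e1
  rw [show s - p + t + p' = s + (p' - p) + t by omega] at e2
  rw [← e1, e2]

theorem centers_aux2 (u : List α) (i j i' j' s : ℕ) (h : IsRun u i j) (h' : IsRun u i' j')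
    (hs : s ∈ centers u i j) (hs' : s ∈ centers u i' j') : i' ≤ i ∧ j ≤ j' := by
  have hpp : minPeriod (factor u i j) = minPeriod (factor u i' j') :=
    le_antisymm (centers_aux u i' j' i j s h' h hs' hs) (centers_aux u i j i' j' s h h' hs hs')
  obtain ⟨hij, hj, -, -, -⟩ := h
  obtain ⟨hij', hj', -, hl', hr'⟩ := h'
  have hp0 := (minPeriod_isPeriod (factor u i j)).1
  have per := run_per u i j hij hj
  simp only [centers, Finset.mem_filter] at hs hs'
  obtain ⟨-, a1, a2, -⟩ := hs
  obtain ⟨-, b1, b2, -⟩ := hs'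
  rw [← hpp] at hl' hr' b1 b2
  generalize minPeriod (factor u i j) = p at *
  constructor
  · by_contra hlt
    rcases hl' with hl' | hl'
    · omega
    · apply hl'
      rw [per (i' - 1) (by omega) (by omega)]
      congr 1; omega
  · by_contra hlt
    rcases hr' with hr' | hr'
    · omega
    · apply hr'
      rw [per (j' - p + 1) (by omega) (by omega)]
      congr 1; omega

theorem centers_card [LinearOrder α] (u : List α) (i j : ℕ) (h : IsCubicRun u i j) :
    exponent u i j - 3 ≤ ((centers u i j).card : ℚ) := by
  obtain ⟨⟨hij, hj, -, -, -⟩, h3⟩ := h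
  have hp0 := (minPeriod_isPeriod (factor u i j)).1
  have per := run_per u i j hij hj
  have hmin := run_min u i j hij hj
  unfold exponent centers
  generalize minPeriod (factor u i j) = p at *
  have hlt : ∀ t, i + t % p < u.length := fun t => by
    have := Nat.mod_lt t hp0
    omega
  let f : ℕ → α := fun t => u[i + t % p]'(hlt t)
  have hfs : ∀ t, some (f t) = u[i + t % p]? := fun t =>
    (List.getElem?_eq_getElem (hlt t)).symm
  have hmul : ∀ m r, i + (r + m * p) ≤ j → u[i + (r + m * p)]? = u[i + r]? := by
    intro m
    induction m with
    | zero => intro r _; simp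
    | succ m ih =>
      intro r hr
      rw [Nat.succ_mul] at hr ⊢
      rw [← ih r (by omega), per (i + (r + m * p)) (by omega) (by omega)]
      congr 1; omega
  have hfu : ∀ t, i + t ≤ j → some (f t) = u[i + t]? := by
    intro t ht
    have hd := Nat.mod_add_div t p
    rw [Nat.mul_comm] at hd
    have := hmul (t / p) (t % p) (by omega)
    rw [hd] at this
    rw [hfs, this]
  have hf : ∀ t, f (t + p) = f t := by intro t; simp [f]
  obtain ⟨s, hs, hsb⟩ := exists_unbordered f p hp0 hf (by
    intro q hq hqp
    obtain ⟨a, ha1, ha2, ha3⟩ := hmin q hq hqp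
    refine ⟨a - i, fun he => ha3 ?_⟩
    have h1 := hfu (a - i) (by omega)
    have h2 := hfu (a - i + q) (by omega)
    rw [he] at h2
    rw [show i + (a - i) = a by omega] at h1
    rw [show i + (a - i + q) = a + q by omega] at h2
    rw [← h1, ← h2])
  set L := j - i + 1 with hL
  set K := (L - s) / p - 1 with hK
  have hKp : ∀ k < K, s + (k + 2) * p ≤ L := by
    intro k hk
    have h1 : k + 2 ≤ (L - s) / p := by omega
    have h2 := (Nat.le_div_iff_mul_le hp0).1 h1
    have : 0 < (k + 2) * p := by positivity
    omega
  have hsub : (Finset.range K).image (fun k => i + (s + (k + 1) * p)) ⊆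
      (Finset.Ico 1 u.length).filter fun s =>
      i + p ≤ s ∧ s + p ≤ j + 1 ∧
      ∀ k, 0 < k → k < p → ∃ t < k, u[s + t]? ≠ u[s + (p - k) + t]? := by
    intro x hx
    simp only [Finset.mem_image, Finset.mem_range] at hx
    obtain ⟨k, hk, rfl⟩ := hx
    have h1 := hKp k hk
    have e1 : (k + 2) * p = k * p + p + p := by ring
    have e2 : (k + 1) * p = k * p + p := by ring
    rw [e1] at h1
    simp only [Finset.mem_filter, Finset.mem_Ico]
    refine ⟨⟨by omega, by omega⟩, by omega, by omega, ?_⟩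
    intro b hb hbp
    obtain ⟨t, ht, hne⟩ := hsb b hb hbp
    refine ⟨t, ht, fun he => hne ?_⟩
    have g1 := hfu (s + t + (k + 1) * p) (by omega)
    have g2 := hfu (s + (p - b) + t + (k + 1) * p) (by omega)
    rw [aux_mod f p hf] at g1 g2
    rw [show i + (s + t + (k + 1) * p) = i + (s + (k + 1) * p) + t by omega] at g1
    rw [show i + (s + (p - b) + t + (k + 1) * p) = i + (s + (k + 1) * p) + (p - b) + t by omega]
      at g2
    rw [← g1, ← g2] at he
    exact Option.some.inj he
  have hcard := Finset.card_le_card hsub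
  rw [Finset.card_image_of_injective _ (by
    intro a b hab
    simp only at hab
    have : (a + 1) * p = (b + 1) * p := by omega
    have := Nat.eq_of_mul_eq_mul_right hp0 this
    omega), Finset.card_range] at hcard
  refine le_trans ?_ (Nat.cast_le.2 hcard)
  have hbig : L ≤ (K + 3) * p := by
    have h1 := Nat.lt_div_mul_add (a := L - s) hp0
    have h2 : (L - s) / p ≤ K + 1 := by omega
    have h3 := Nat.mul_le_mul_right p h2
    have e : (K + 3) * p = (K + 1) * p + p + p := by ring
    omega
  have hpq : (0 : ℚ) < p := by exact_mod_cast hp0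
  rw [sub_le_iff_le_add, div_le_iff₀ hpq]
  have hLq : (j : ℚ) - i + 1 = (L : ℚ) := by
    rw [hL]; push_cast [Nat.cast_sub hij]; ring
  rw [hLq]
  exact_mod_cast hbig

/-- For any word `u` of length `n ≥ 1`, `σ_cubic(u) < 3 ρ_cubic(u) + n`. -/
theorem sigmaCubic_lt_three_rhoCubic_add_length [LinearOrder α] (u : List α)
    (hn : 1 ≤ u.length) :
    sigmaCubic u < 3 * ((cubicRuns u).card : ℚ) + (u.length : ℚ) := by
  have hdisj : ((cubicRuns u : Finset (ℕ × ℕ)) : Set (ℕ × ℕ)).PairwiseDisjoint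
      (fun q => centers u q.1 q.2) := by
    intro a ha b hb hab
    simp only [cubicRuns, Finset.coe_filter, Set.mem_ofPred_eq] at ha hb
    refine Finset.disjoint_left.2 fun s hs hs' => hab ?_
    have h1 := centers_aux2 u _ _ _ _ s ha.2.1 hb.2.1 hs hs'
    have h2 := centers_aux2 u _ _ _ _ s hb.2.1 ha.2.1 hs' hs
    exact Prod.ext (le_antisymm h2.1 h1.1) (le_antisymm h1.2 h2.2)
  have hc : ∑ q ∈ cubicRuns u, (centers u q.1 q.2).card ≤ u.length - 1 := by
    rw [← Finset.card_biUnion hdisj, ← Nat.card_Ico 1 u.length]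
    apply Finset.card_le_card
    apply Finset.biUnion_subset.2
    intro q _
    exact Finset.filter_subset _ _
  have hsum : ∑ q ∈ cubicRuns u, (exponent u q.1 q.2 - 3) ≤
      ∑ q ∈ cubicRuns u, ((centers u q.1 q.2).card : ℚ) :=
    Finset.sum_le_sum fun q hq => centers_card u q.1 q.2 (Finset.mem_filter.1 hq).2
  rw [Finset.sum_sub_distrib, Finset.sum_const, nsmul_eq_mul] at hsum
  have hc' : ∑ q ∈ cubicRuns u, ((centers u q.1 q.2).card : ℚ) < (u.length : ℚ) := by
    have : ∑ q ∈ cubicRuns u, (centers u q.1 q.2).card < u.length := by omega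
    exact_mod_cast this
  unfold sigmaCubic
  linarith
end RunsExp
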